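/- arXiv:1110.6167 — 2 statements merged into one kernel-verified Lean document; each statement's English description precedes it below -/
import Mathlib

section
/- Let (x_i)_{i≥1} be a sequence of points in [0,1]. Suppose there exists a constant c > 0 such that for every nondegenerate interval J ⊆ [0,1] one has liminf_{N→∞} λ((⋃_{i=1}^{N} B(x_i, 1/N)) ∩ J) ≥ c·λ(J), where λ denotes Lebesgue measure and B(x,r) is the open ball of radius r about x. Then for every nonincreasing sequence (r_i)_{i≥1} of positive real numbers with ∑_{i=1}^{∞} r_i = ∞, the limsup set ⋂_{n=1}^{∞} ⋃_{i=n}^{∞} B(x_i, r_i) has Lebesgue measure 1 in [0,1]. -/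
open MeasureTheory Filter

/-- In dimension one, enlarging the balls of a finite family by a factor `K ≥ 1` multiplies the
measure of their union by at most `5 * K`. -/
theorem measureReal_biUnion_ball_mul_le {ι : Type*} (S : Finset ι) (y s : ι → ℝ)
    (hs : ∀ i ∈ S, 0 < s i) {K : ℝ} (hK : 1 ≤ K) :
    volume.real (⋃ i ∈ S, Metric.ball (y i) (K * s i)) ≤
      5 * K * volume.real (⋃ i ∈ S, Metric.ball (y i) (s i)) := by
  classical
  obtain ⟨R, hR⟩ := (S.image s).bddAbove
  obtain ⟨u, huS, hdisj, hcov⟩ := Vitali.exists_disjoint_subfamily_covering_enlargement_closedBall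
    (S : Set ι) y s R (fun i hi => hR (by simpa using ⟨i, hi, rfl⟩)) 5 (by norm_num)
  lift u to Finset ι using S.finite_toSet.subset huS
  have huS' : u ⊆ S := by exact_mod_cast huS
  have hsub : (⋃ i ∈ S, Metric.ball (y i) (K * s i)) ⊆
      ⋃ i ∈ u, Metric.ball (y i) (5 * K * s i) := by
    intro z hz
    simp only [Set.mem_iUnion, exists_prop] at hz ⊢
    obtain ⟨i, hi, hz⟩ := hz
    obtain ⟨j, hj, hij⟩ := hcov i hi
    refine ⟨j, hj, ?_⟩
    have hi0 := hs i hi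
    rw [Real.closedBall_eq_Icc, Real.closedBall_eq_Icc,
      Set.Icc_subset_Icc_iff (by linarith)] at hij
    rw [Real.ball_eq_Ioo, Set.mem_Ioo] at hz ⊢
    have h1 : (K - 1) * s i ≤ (K - 1) * (5 * s j) := by
      apply mul_le_mul_of_nonneg_left _ (by linarith)
      linarith [hij.1, hij.2]
    constructor <;> linarith [hij.1, hij.2, hz.1, hz.2]
  have hdisj' : (u : Set ι).PairwiseDisjoint fun i => Metric.ball (y i) (s i) :=
    hdisj.mono fun i => Metric.ball_subset_closedBall
  calc volume.real (⋃ i ∈ S, Metric.ball (y i) (K * s i))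
      ≤ volume.real (⋃ i ∈ u, Metric.ball (y i) (5 * K * s i)) :=
        measureReal_mono hsub (measure_biUnion_lt_top u.finite_toSet fun _ _ =>
          measure_ball_lt_top).ne
    _ ≤ ∑ i ∈ u, volume.real (Metric.ball (y i) (5 * K * s i)) := measureReal_biUnion_finset_le _ _
    _ = 5 * K * ∑ i ∈ u, volume.real (Metric.ball (y i) (s i)) := by
        rw [Finset.mul_sum]
        refine Finset.sum_congr rfl fun i hi => ?_
        have := hs i (huS' hi)
        rw [Real.volume_real_ball (by positivity), Real.volume_real_ball this.le]
        ring
    _ = 5 * K * volume.real (⋃ i ∈ u, Metric.ball (y i) (s i)) := by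
        rw [measureReal_biUnion_finset hdisj' (fun _ _ => Metric.isOpen_ball.measurableSet)
          (fun _ _ => measure_ball_lt_top.ne)]
    _ ≤ 5 * K * volume.real (⋃ i ∈ S, Metric.ball (y i) (s i)) := by
        refine mul_le_mul_of_nonneg_left (measureReal_mono ?_ ?_) (by linarith)
        · exact Set.biUnion_subset_biUnion_left huS'
        · exact (measure_biUnion_lt_top S.finite_toSet fun _ _ => measure_ball_lt_top).ne

theorem measureReal_biUnion_ball_le_card {ι : Type*} (S : Finset ι) (y s : ι → ℝ) {δ : ℝ}
    (hδ : 0 ≤ δ) (hs : ∀ i ∈ S, s i ≤ δ) :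
    volume.real (⋃ i ∈ S, Metric.ball (y i) (s i)) ≤ 2 * δ * S.card := by
  calc volume.real (⋃ i ∈ S, Metric.ball (y i) (s i))
      ≤ ∑ i ∈ S, volume.real (Metric.ball (y i) (s i)) := measureReal_biUnion_finset_le _ _
    _ ≤ ∑ _i ∈ S, 2 * δ := Finset.sum_le_sum fun i hi => by
        rw [← Real.volume_real_ball (a := y i) hδ]
        exact measureReal_mono (Metric.ball_subset_ball (hs i hi)) measure_ball_lt_top.ne
    _ = 2 * δ * S.card := by simp [mul_comm]

theorem measureReal_biUnion_ball_add_le {ι : Type*} (S : Finset ι) (y s : ι → ℝ)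
    (hs : ∀ i ∈ S, 0 < s i) {δ : ℝ} (hδ : 0 ≤ δ) :
    volume.real (⋃ i ∈ S, Metric.ball (y i) (s i + δ)) ≤
      10 * volume.real (⋃ i ∈ S, Metric.ball (y i) (s i)) + 4 * δ * S.card := by
  classical
  have hfin : ∀ (T : Finset ι) (t : ι → ℝ), volume (⋃ i ∈ T, Metric.ball (y i) (t i)) ≠ ⊤ :=
    fun T t => (measure_biUnion_lt_top T.finite_toSet fun _ _ => measure_ball_lt_top).ne
  have hsub : (⋃ i ∈ S, Metric.ball (y i) (s i + δ)) ⊆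
      (⋃ i ∈ S, Metric.ball (y i) (2 * s i)) ∪
        ⋃ i ∈ S.filter (s · ≤ δ), Metric.ball (y i) (s i + δ) := by
    intro z hz
    simp only [Set.mem_union, Set.mem_iUnion, exists_prop, Finset.mem_filter] at hz ⊢
    obtain ⟨i, hi, hz⟩ := hz
    rcases le_total (s i) δ with h | h
    · exact Or.inr ⟨i, ⟨hi, h⟩, hz⟩
    · exact Or.inl ⟨i, hi, Metric.ball_subset_ball (by linarith) hz⟩
  have h1 := measureReal_biUnion_ball_mul_le S y s hs (K := 2) (by norm_num)
  have h2 := measureReal_biUnion_ball_le_card (S.filter (s · ≤ δ)) y (fun i => s i + δ)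
    (δ := 2 * δ) (by linarith) (fun i hi => by linarith [(Finset.mem_filter.1 hi).2])
  have h3 : ((S.filter (s · ≤ δ)).card : ℝ) ≤ S.card := by
    exact_mod_cast Finset.card_filter_le _ _
  have h4 := measureReal_mono hsub
    (measure_union_ne_top (hfin S fun i => 2 * s i)
      (hfin (S.filter (s · ≤ δ)) fun i => s i + δ))
  have h5 := measureReal_union_le (μ := volume) (⋃ i ∈ S, Metric.ball (y i) (2 * s i))
    (⋃ i ∈ S.filter (s · ≤ δ), Metric.ball (y i) (s i + δ))
  have h6 := mul_le_mul_of_nonneg_left h3 (by linarith : 0 ≤ 4 * δ)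
  linarith

/-- The union of the balls `B(x i, s i)` with `n ≤ i ≤ m` centred within `2 * ρ` of `d`. -/
def localUnion (x s : ℕ → ℝ) (d ρ : ℝ) (n m : ℕ) : Set ℝ :=
  ⋃ i ∈ (Finset.Icc n m).filter (fun i => |x i - d| ≤ 2 * ρ), Metric.ball (x i) (s i)

theorem volume_localUnion_ne_top (x s : ℕ → ℝ) (d ρ : ℝ) (n m : ℕ) :
    volume (localUnion x s d ρ n m) ≠ ⊤ :=
  (measure_biUnion_lt_top (Finset.finite_toSet _) fun _ _ => measure_ball_lt_top).ne

theorem measurableSet_localUnion (x s : ℕ → ℝ) (d ρ : ℝ) (n m : ℕ) :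
    MeasurableSet (localUnion x s d ρ n m) :=
  Finset.measurableSet_biUnion _ fun _ _ => Metric.isOpen_ball.measurableSet

theorem measureReal_localUnion_add_le {x s : ℕ → ℝ} {d ρ : ℝ} {n P N : ℕ} (hn : 1 ≤ n)
    (hnN : n ≤ N) (hPN : P ≤ N) (hN : 1 / (N : ℝ) ≤ ρ) (hspos : ∀ i, 1 ≤ i → 0 < s i)
    (hsmono : ∀ i j, 1 ≤ i → i ≤ j → s j ≤ s i) (hsN : s N ≤ 1 / N) :
    volume.real (localUnion x s d ρ n P) + N * s N / 5 *
        (volume.real ((⋃ i ∈ Finset.Icc 1 N, Metric.ball (x i) (1 / N)) ∩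
            Set.Icc (d - ρ) (d + ρ)) -
          10 * volume.real (localUnion x s d ρ n P) - 8 * P / N - 2 * n / N) ≤
      volume.real (localUnion x s d ρ n N) := by
  classical
  have hN0 : 0 < (N : ℝ) := by exact_mod_cast (by omega : 0 < N)
  have hsN0 : 0 < s N := hspos N (by omega)
  set A := (Finset.Icc n P).filter (fun i => |x i - d| ≤ 2 * ρ) with hA
  set U := localUnion x s d ρ n P with hU
  have hU' : U = ⋃ i ∈ A, Metric.ball (x i) (s i) := rfl
  set B := (Finset.Icc n N).filter
    (fun i => |x i - d| ≤ 2 * ρ ∧ ∀ j ∈ A, s j + s N ≤ |x i - x j|) with hB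
  set W := ⋃ i ∈ B, Metric.ball (x i) (s N) with hW
  have hfin : ∀ (T : Finset ℕ) (t : ℕ → ℝ), volume (⋃ i ∈ T, Metric.ball (x i) (t i)) ≠ ⊤ :=
    fun T t => (measure_biUnion_lt_top T.finite_toSet fun _ _ => measure_ball_lt_top).ne
  have hUW : Disjoint U W := by
    rw [hU', hW, Set.disjoint_left]
    intro z hz hz'
    simp only [Set.mem_iUnion, exists_prop, Metric.mem_ball, Real.dist_eq] at hz hz'
    obtain ⟨j, hj, hz⟩ := hz
    obtain ⟨i, hi, hz'⟩ := hz'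
    have := (Finset.mem_filter.1 hi).2.2 j hj
    have := abs_sub_le (x i) z (x j)
    rw [abs_sub_comm (x i) z] at this
    linarith
  have hsub : U ∪ W ⊆ localUnion x s d ρ n N := by
    intro z hz
    simp only [hU', hW, hA, hB, localUnion, Set.mem_union, Set.mem_iUnion, exists_prop,
      Finset.mem_filter, Finset.mem_Icc] at hz ⊢
    rcases hz with ⟨i, ⟨⟨h1, h2⟩, h3⟩, h4⟩ | ⟨i, ⟨⟨h1, h2⟩, h3, _⟩, h4⟩
    · exact ⟨i, ⟨⟨h1, h2.trans hPN⟩, h3⟩, h4⟩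
    · exact ⟨i, ⟨⟨h1, h2⟩, h3⟩, Metric.ball_subset_ball (hsmono i N (by omega) h2) h4⟩
  have hsum : volume.real U + volume.real W ≤ volume.real (localUnion x s d ρ n N) := by
    rw [← measureReal_union hUW
      (Finset.measurableSet_biUnion _ fun _ _ => Metric.isOpen_ball.measurableSet)
      (hfin A s) (hfin B fun _ => s N)]
    exact measureReal_mono hsub (volume_localUnion_ne_top _ _ _ _ _ _)
  have hvit := measureReal_biUnion_ball_mul_le B x (fun _ => s N) (fun _ _ => hsN0)
    (K := 1 / (N * s N)) (by
      rw [le_div_iff₀ (by positivity), one_mul]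
      rwa [le_div_iff₀ hN0, mul_comm] at hsN)
  have hK : 1 / (N * s N) * s N = 1 / N := by field_simp
  rw [hK] at hvit
  have hcov : (⋃ i ∈ Finset.Icc 1 N, Metric.ball (x i) (1 / N)) ∩ Set.Icc (d - ρ) (d + ρ) ⊆
      (⋃ i ∈ B, Metric.ball (x i) (1 / N)) ∪ ((⋃ i ∈ A, Metric.ball (x i) (s i + 2 / N)) ∪
        ⋃ i ∈ Finset.range n, Metric.ball (x i) (1 / N)) := by
    rintro z ⟨hz, hzd⟩
    simp only [Set.mem_union, Set.mem_iUnion, exists_prop, Finset.mem_Icc, Finset.mem_range,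
      Metric.mem_ball, Real.dist_eq] at hz ⊢
    obtain ⟨i, ⟨h1, h2⟩, hz⟩ := hz
    by_cases hin : i < n
    · exact Or.inr (Or.inr ⟨i, hin, hz⟩)
    have hid : |x i - d| ≤ 2 * ρ := by
      rw [abs_lt] at hz
      rw [abs_le]
      constructor <;> linarith [hzd.1, hzd.2, hz.1, hz.2]
    by_cases hj : ∀ j ∈ A, s j + s N ≤ |x i - x j|
    · exact Or.inl ⟨i, Finset.mem_filter.2 ⟨Finset.mem_Icc.2 ⟨by omega, h2⟩, hid, hj⟩, hz⟩
    · push Not at hj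
      obtain ⟨j, hjA, hj⟩ := hj
      refine Or.inr (Or.inl ⟨j, hjA, ?_⟩)
      have := abs_sub_le z (x i) (x j)
      have h2N : 2 / (N : ℝ) = 1 / N + 1 / N := by ring
      linarith
  have h1 := measureReal_mono hcov (measure_union_ne_top (hfin B fun _ => 1 / N)
    (measure_union_ne_top (hfin A fun i => s i + 2 / N) (hfin (Finset.range n) fun _ => 1 / N)))
  have h2 := measureReal_union_le (μ := volume) (⋃ i ∈ B, Metric.ball (x i) (1 / N))
    ((⋃ i ∈ A, Metric.ball (x i) (s i + 2 / N)) ∪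
        ⋃ i ∈ Finset.range n, Metric.ball (x i) (1 / N))
  have h3 := measureReal_union_le (μ := volume) (⋃ i ∈ A, Metric.ball (x i) (s i + 2 / N))
    (⋃ i ∈ Finset.range n, Metric.ball (x i) (1 / N))
  have h4 := measureReal_biUnion_ball_le_card (Finset.range n) x (fun _ => 1 / (N : ℝ))
    (δ := 1 / N) (by positivity) (fun _ _ => le_rfl)
  have h5 := measureReal_biUnion_ball_add_le A x s
    (fun i hi => hspos i (by have := Finset.mem_Icc.1 (Finset.mem_filter.1 hi).1; omega))
    (δ := 2 / N) (by positivity)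
  have hcard : (A.card : ℝ) ≤ P := by
    have : A.card ≤ P := (Finset.card_filter_le _ _).trans (by simp; omega)
    exact_mod_cast this
  have h6 : 4 * (2 / (N : ℝ)) * A.card ≤ 8 * P / N := by
    calc 4 * (2 / (N : ℝ)) * A.card ≤ 4 * (2 / (N : ℝ)) * P := by gcongr
      _ = 8 * P / N := by ring
  rw [Finset.card_range, show 2 * (1 / (N : ℝ)) * n = 2 * n / N by ring] at h4
  have h7 : volume.real ((⋃ i ∈ Finset.Icc 1 N, Metric.ball (x i) (1 / N)) ∩
            Set.Icc (d - ρ) (d + ρ)) - 10 * volume.real U - 8 * P / N - 2 * n / N ≤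
        5 * (1 / (N * s N)) * volume.real W := by
    rw [← hU'] at h5
    linarith
  have h8 := mul_le_mul_of_nonneg_left h7 (by positivity : 0 ≤ N * s N / 5)
  have h9 : N * s N / 5 * (5 * (1 / (N * s N)) * volume.real W) = volume.real W := by
    field_simp
  linarith

theorem localUnion_subset {x s : ℕ → ℝ} {d ρ : ℝ} {n m : ℕ} (hs : ∀ i, n ≤ i → s i ≤ ρ) :
    localUnion x s d ρ n m ⊆
      (⋃ i, ⋃ (_ : n ≤ i), Metric.ball (x i) (s i)) ∩ Metric.closedBall d (3 * ρ) := by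
  intro z hz
  simp only [localUnion, Set.mem_iUnion, exists_prop, Finset.mem_filter, Finset.mem_Icc] at hz
  obtain ⟨i, ⟨⟨h1, _⟩, h3⟩, h4⟩ := hz
  refine ⟨by simpa using ⟨i, h1, h4⟩, ?_⟩
  rw [Metric.mem_ball, Real.dist_eq] at h4
  rw [Metric.mem_closedBall, Real.dist_eq]
  linarith [abs_sub_le z (x i) d, hs i h1]

theorem measureReal_iUnion_ball_inter_ge {x s : ℕ → ℝ} {c d ρ : ℝ} (hc : 0 < c) (hρ : 0 < ρ)
    (H : ∀ᶠ N : ℕ in atTop, c * ρ ≤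
      volume.real ((⋃ i ∈ Finset.Icc 1 N, Metric.ball (x i) (1 / N)) ∩ Set.Icc (d - ρ) (d + ρ)))
    (hspos : ∀ i, 1 ≤ i → 0 < s i) (hsmono : ∀ i j, 1 ≤ i → i ≤ j → s j ≤ s i)
    (hsle : ∀ i, 1 ≤ i → s i ≤ 1 / i)
    (hdiv : ∀ M : ℕ, 2 ≤ M → ¬ Summable fun k : ℕ => (M : ℝ) ^ k * s (M ^ k)) (n : ℕ) :
    c / 40 * ρ ≤ volume.real
      ((⋃ i, ⋃ (_ : n ≤ i), Metric.ball (x i) (s i)) ∩ Metric.closedBall d (3 * ρ)) := by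
  by_contra! hlt
  have hcρ : 0 < c * ρ := mul_pos hc hρ
  obtain ⟨m, hm⟩ := exists_nat_gt (1 / ρ)
  set n' := max n (max m 1) with hn'
  have hinv : ∀ i : ℕ, n' ≤ i → 1 / (i : ℝ) ≤ ρ := by
    intro i hi
    have hmi : (m : ℝ) ≤ i := by exact_mod_cast (by omega : m ≤ i)
    have hi0 : (0 : ℝ) < i := by exact_mod_cast (by omega : 0 < i)
    rw [div_le_iff₀ hi0]
    rw [div_lt_iff₀ hρ] at hm
    nlinarith
  have hsmall : ∀ k, volume.real (localUnion x s d ρ n' k) ≤ c / 40 * ρ := by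
    intro k
    refine (measureReal_mono ?_ ?_).trans hlt.le
    · refine (localUnion_subset fun i hi => (hsle i (by omega)).trans (hinv i hi)).trans ?_
      refine Set.inter_subset_inter_left _ (Set.iUnion_mono fun i => ?_)
      exact Set.iUnion_mono' fun h => ⟨by omega, le_rfl⟩
    · exact measure_inter_ne_top_of_right_ne_top (isCompact_closedBall _ _).measure_ne_top
  obtain ⟨M, hM⟩ := exists_nat_gt (max 2 (32 / (c * ρ)))
  rw [max_lt_iff] at hM
  have hM2 : 2 ≤ M := by exact_mod_cast hM.1.le
  have hM0 : (0 : ℝ) < M := by linarith [hM.1]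
  have hpow : Tendsto (fun k : ℕ => M ^ k) atTop atTop := tendsto_pow_atTop_atTop_of_one_lt hM2
  have hev : ∀ᶠ N : ℕ in atTop, n' ≤ N ∧ 2 * (n' : ℝ) / N ≤ c * ρ / 4 ∧ c * ρ ≤
      volume.real ((⋃ i ∈ Finset.Icc 1 N, Metric.ball (x i) (1 / N)) ∩
        Set.Icc (d - ρ) (d + ρ)) := by
    refine (eventually_ge_atTop n').and (Eventually.and ?_ H)
    exact (tendsto_const_div_atTop_nhds_zero_nat (2 * (n' : ℝ))).eventually_le_const
      (by positivity)
  obtain ⟨k₀, hk₀⟩ := eventually_atTop.1 (hpow.eventually hev)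
  have hstep : ∀ k, k₀ ≤ k → volume.real (localUnion x s d ρ n' (M ^ k)) +
      c * ρ / 20 * ((M : ℝ) ^ (k + 1) * s (M ^ (k + 1))) ≤
        volume.real (localUnion x s d ρ n' (M ^ (k + 1))) := by
    intro k hk
    obtain ⟨h1, h2, h3⟩ := hk₀ (k + 1) (by omega)
    have hpos : 1 ≤ M ^ (k + 1) := Nat.one_le_pow _ _ (by omega)
    have key := measureReal_localUnion_add_le (x := x) (d := d) (by omega) h1
      (Nat.pow_le_pow_right (by omega) (Nat.le_succ k)) (hinv _ h1) hspos hsmono (hsle _ hpos)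
    have hP : 8 * ((M ^ k : ℕ) : ℝ) / (M ^ (k + 1) : ℕ) ≤ c * ρ / 4 := by
      have : 8 * ((M ^ k : ℕ) : ℝ) / (M ^ (k + 1) : ℕ) = 8 / M := by
        push_cast
        rw [pow_succ]
        field_simp
      rw [this, div_le_iff₀ hM0]
      have := hM.2
      rw [div_lt_iff₀ hcρ] at this
      linarith
    have hs0 := hspos _ hpos
    have hbr := mul_le_mul_of_nonneg_left
      (by linarith [hsmall (M ^ k)] : c * ρ / 4 ≤
        volume.real ((⋃ i ∈ Finset.Icc 1 (M ^ (k + 1)),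
          Metric.ball (x i) (1 / (M ^ (k + 1) : ℕ))) ∩ Set.Icc (d - ρ) (d + ρ)) -
          10 * volume.real (localUnion x s d ρ n' (M ^ k)) -
          8 * ((M ^ k : ℕ) : ℝ) / (M ^ (k + 1) : ℕ) - 2 * n' / (M ^ (k + 1) : ℕ))
      (by positivity : 0 ≤ ((M ^ (k + 1) : ℕ) : ℝ) * s (M ^ (k + 1)) / 5)
    have hcast : ((M ^ (k + 1) : ℕ) : ℝ) = (M : ℝ) ^ (k + 1) := by push_cast; rfl
    rw [hcast] at key hbr
    linarith
  have hpart : ∀ l, c * ρ / 20 * ∑ j ∈ Finset.range l,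
      ((M : ℝ) ^ (j + (k₀ + 1)) * s (M ^ (j + (k₀ + 1)))) ≤
        volume.real (localUnion x s d ρ n' (M ^ (k₀ + l))) := by
    intro l
    induction l with
    | zero => simp
    | succ l ih =>
      have := hstep (k₀ + l) (by omega)
      rw [Finset.sum_range_succ, mul_add, show l + (k₀ + 1) = k₀ + l + 1 by omega,
        ← add_assoc k₀ l 1]
      linarith
  refine hdiv M hM2 ((summable_nat_add_iff (k₀ + 1)).1 ?_)
  refine summable_of_sum_range_le (c := 1 / 2) (fun j => ?_) fun l => ?_
  · have := hspos _ (Nat.one_le_pow (j + (k₀ + 1)) M (by omega))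
    positivity
  · have := (hpart l).trans (hsmall _)
    by_contra! h
    nlinarith

/-- Truncating at `1 / i` keeps the condensed series of a divergent nonincreasing series
divergent. -/
theorem not_summable_pow_mul_min {r : ℕ → ℝ} (hrpos : ∀ i, 1 ≤ i → 0 < r i)
    (hrmono : ∀ i j, 1 ≤ i → i ≤ j → r j ≤ r i) (hrdiv : ¬ Summable fun i : ℕ => r (i + 1))
    {M : ℕ} (hM : 2 ≤ M) :
    ¬ Summable fun k : ℕ => (M : ℝ) ^ k * min (r (M ^ k)) (1 / (M ^ k : ℕ)) := by
  intro hsum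
  apply hrdiv
  have hM0 : (0 : ℝ) < M := by exact_mod_cast (by omega : 0 < M)
  have hM1 : (1 : ℝ) < M := by exact_mod_cast (by omega : 1 < M)
  have hev : ∀ᶠ k : ℕ in atTop, (M : ℝ) ^ k * min (r (M ^ k)) (1 / (M ^ k : ℕ)) =
      (M : ℝ) ^ k * r (M ^ k) := by
    filter_upwards [hsum.tendsto_atTop_zero.eventually_lt_const one_pos] with k hk
    rcases le_total (r (M ^ k)) (1 / (M ^ k : ℕ)) with h | h
    · rw [min_eq_left h]
    · rw [min_eq_right h] at hk
      push_cast at hk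
      rw [mul_one_div_cancel (by positivity)] at hk
      exact absurd hk (lt_irrefl _)
  have hcond : Summable fun k : ℕ => (M : ℝ) ^ k * r (M ^ k) :=
    hsum.congr_atTop hev
  have hmax : Summable fun i : ℕ => r (max i 1) := by
    refine (summable_schlomilch_iff_of_nonneg (C := M) (u := fun k => M ^ k)
      (fun i => (hrpos _ (le_max_right _ _)).le)
      (fun i j _ hij => hrmono _ _ (le_max_right _ _) (max_le_max_right _ hij))
      (fun k => by positivity) (pow_right_strictMono₀ (by omega)) (by omega) ?_).1 ?_
    · intro k
      rw [smul_eq_mul, Nat.mul_sub, ← pow_succ', ← pow_succ']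
    · refine (hcond.mul_left ((M : ℝ) - 1)).congr fun k => ?_
      rw [max_eq_left (Nat.one_le_pow _ _ (by omega))]
      push_cast
      ring
  simpa using (summable_nat_add_iff 1).2 hmax

/-- A subset of a bounded open interval occupying a fixed proportion of all small closed balls has
full measure there. -/
theorem volume_diff_eq_zero_of_forall_closedBall {E : Set ℝ} (hE : MeasurableSet E) {a b ε : ℝ}
    (hε : 0 < ε)
    (h : ∀ d ρ, 0 < ρ → Metric.closedBall d ρ ⊆ Set.Ioo a b →
      ε * volume.real (Metric.closedBall d ρ) ≤ volume.real (E ∩ Metric.closedBall d ρ)) :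
    volume (Set.Ioo a b \ E) = 0 := by
  rw [measure_eq_zero_iff_ae_notMem]
  filter_upwards [Besicovitch.ae_tendsto_measure_inter_div_of_measurableSet volume hE]
    with d hd hdE
  rw [Set.indicator_of_notMem hdE.2] at hd
  have h1 := hd.eventually_lt_const (ENNReal.ofReal_pos.2 hε)
  obtain ⟨δ, hδ, hball⟩ := Metric.isOpen_iff.1 isOpen_Ioo d hdE.1
  obtain ⟨ρ, hlt, hρ, hρδ⟩ := (h1.and (Ioo_mem_nhdsGT hδ)).exists
  have h2 := h d ρ hρ ((Metric.closedBall_subset_ball hρδ).trans hball)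
  have hfin : volume (Metric.closedBall d ρ) ≠ ⊤ := (isCompact_closedBall _ _).measure_ne_top
  have hfin' : volume (E ∩ Metric.closedBall d ρ) ≠ ⊤ :=
    measure_inter_ne_top_of_right_ne_top hfin
  have hpos : volume (Metric.closedBall d ρ) ≠ 0 := (Metric.measure_closedBall_pos _ _ hρ).ne'
  rw [ENNReal.div_lt_iff (Or.inl hpos) (Or.inl hfin), ← ofReal_measureReal hfin,
    ← ofReal_measureReal hfin', ← ENNReal.ofReal_mul hε.le] at hlt
  exact absurd h2 (not_le.2 (ENNReal.ofReal_lt_ofReal_iff'.1 hlt).1)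

/-- Borel–Cantelli type theorem (Theorem 4 of the paper).  Here the ball
`B(x,r)` is the open interval `(x-r, x+r)` intersected with `[0,1]`. -/
theorem stmt_0
    (x : ℕ → ℝ) (hx : ∀ i, 1 ≤ i → x i ∈ Set.Icc (0 : ℝ) 1)
    (c : ℝ) (hc : 0 < c)
    (H : ∀ a b : ℝ, 0 ≤ a → a < b → b ≤ 1 →
      ENNReal.ofReal (c * (b - a)) ≤
        Filter.atTop.liminf (fun N : ℕ =>
          volume ((⋃ i ∈ Finset.Icc 1 N,
            (Set.Ioo (x i - 1 / (N : ℝ)) (x i + 1 / (N : ℝ)) ∩ Set.Icc (0 : ℝ) 1))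
              ∩ Set.Icc a b)))
    (r : ℕ → ℝ) (hrpos : ∀ i, 1 ≤ i → 0 < r i)
    (hrmono : ∀ i j, 1 ≤ i → i ≤ j → r j ≤ r i)
    (hrdiv : ¬ Summable (fun i : ℕ => r (i + 1))) :
    volume (⋂ n : ℕ, ⋃ i : ℕ, ⋃ (_ : n ≤ i ∧ 1 ≤ i),
      (Set.Ioo (x i - r i) (x i + r i) ∩ Set.Icc (0 : ℝ) 1)) = 1 := by
  set F : ℕ → Set ℝ := fun n => ⋃ i : ℕ, ⋃ (_ : n ≤ i ∧ 1 ≤ i),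
      (Set.Ioo (x i - r i) (x i + r i) ∩ Set.Icc (0 : ℝ) 1) with hF
  have hFmeas : ∀ n, MeasurableSet (F n) := fun n =>
    MeasurableSet.iUnion fun i => MeasurableSet.iUnion fun _ =>
      measurableSet_Ioo.inter measurableSet_Icc
  have hFanti : Antitone F := fun n m hnm => Set.iUnion_mono fun i =>
    Set.iUnion_mono' fun h => ⟨⟨hnm.trans h.1, h.2⟩, le_rfl⟩
  have hFsub : (⋂ n, F n) ⊆ Set.Icc 0 1 := by
    refine (Set.iInter_subset _ 0).trans ?_
    exact Set.iUnion_subset fun i => Set.iUnion_subset fun _ => Set.inter_subset_right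
  have hlocal : ∀ d ρ, 0 < ρ → Metric.closedBall d (3 * ρ) ⊆ Set.Ioo 0 1 → ∀ n,
      c / 40 * ρ ≤ volume.real (F n ∩ Metric.closedBall d (3 * ρ)) := by
    intro d ρ hρ hsub n
    have hd1 := hsub (show d - ρ ∈ Metric.closedBall d (3 * ρ) by
      rw [Metric.mem_closedBall, Real.dist_eq, abs_le]; constructor <;> linarith)
    have hd2 := hsub (show d + ρ ∈ Metric.closedBall d (3 * ρ) by
      rw [Metric.mem_closedBall, Real.dist_eq, abs_le]; constructor <;> linarith)
    have hH : ∀ᶠ N : ℕ in atTop, c * ρ ≤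
        volume.real ((⋃ i ∈ Finset.Icc 1 N, Metric.ball (x i) (1 / N)) ∩
          Set.Icc (d - ρ) (d + ρ)) := by
      have hlt := (ENNReal.ofReal_lt_ofReal_iff (by nlinarith)).2
        (by nlinarith : c * ρ < c * (d + ρ - (d - ρ)))
      filter_upwards [eventually_lt_of_lt_liminf (hlt.trans_le
        (H (d - ρ) (d + ρ) hd1.1.le (by linarith) hd2.2.le))] with N hN
      have hfin : volume ((⋃ i ∈ Finset.Icc 1 N, Metric.ball (x i) (1 / N)) ∩
          Set.Icc (d - ρ) (d + ρ)) ≠ ⊤ :=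
        measure_inter_ne_top_of_right_ne_top isCompact_Icc.measure_ne_top
      rw [measureReal_def, ← ENNReal.ofReal_le_iff_le_toReal hfin]
      refine hN.le.trans (measure_mono (Set.inter_subset_inter_left _ ?_))
      refine Set.iUnion₂_mono fun i _ => ?_
      rw [Real.ball_eq_Ioo]
      exact Set.inter_subset_left
    have key := measureReal_iUnion_ball_inter_ge (s := fun i => min (r i) (1 / i)) hc hρ hH
      (fun i hi => lt_min (hrpos i hi) (by
        have : (0 : ℝ) < i := by exact_mod_cast hi
        positivity))
      (fun i j hi hij => min_le_min (hrmono i j hi hij) (by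
        have : (0 : ℝ) < i := by exact_mod_cast hi
        gcongr))
      (fun i _ => min_le_right _ _)
      (fun M hM => not_summable_pow_mul_min hrpos hrmono hrdiv hM) (max n 1)
    refine key.trans (measureReal_mono ?_ ?_)
    · rintro z ⟨hz, hzd⟩
      refine ⟨?_, hzd⟩
      simp only [hF, Set.mem_iUnion, exists_prop] at hz ⊢
      obtain ⟨i, hi, hz⟩ := hz
      refine ⟨i, max_le_iff.1 hi, ?_, Set.Ioo_subset_Icc_self (hsub hzd)⟩
      rw [← Real.ball_eq_Ioo]
      exact Metric.ball_subset_ball (min_le_left _ _) hz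
    · exact measure_inter_ne_top_of_right_ne_top (isCompact_closedBall _ _).measure_ne_top
  have hzero : volume (Set.Ioo (0 : ℝ) 1 \ ⋂ n, F n) = 0 := by
    refine volume_diff_eq_zero_of_forall_closedBall (MeasurableSet.iInter hFmeas)
      (ε := c / 240) (by positivity) fun d ρ hρ hsub => ?_
    have hfin : ∀ S : Set ℝ, volume (S ∩ Metric.closedBall d ρ) ≠ ⊤ := fun S =>
      measure_inter_ne_top_of_right_ne_top (isCompact_closedBall _ _).measure_ne_top
    have hlim : Tendsto (fun n => volume.real (F n ∩ Metric.closedBall d ρ)) atTop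
        (nhds (volume.real ((⋂ n, F n) ∩ Metric.closedBall d ρ))) := by
      refine (ENNReal.tendsto_toReal (hfin _)).comp ?_
      rw [Set.iInter_inter]
      exact tendsto_measure_iInter_atTop
        (fun n => ((hFmeas n).inter Metric.isClosed_closedBall.measurableSet).nullMeasurableSet)
        (fun n m hnm => Set.inter_subset_inter_left _ (hFanti hnm)) ⟨0, hfin _⟩
    refine ge_of_tendsto' hlim fun n => ?_
    have h3 : 3 * (ρ / 3) = ρ := by ring
    have := hlocal d (ρ / 3) (by positivity) (by rwa [h3]) n
    rw [h3] at this
    rw [Real.volume_real_closedBall hρ.le]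
    linarith
  refine le_antisymm ((measure_mono hFsub).trans (by simp)) ?_
  calc (1 : ENNReal) = volume (Set.Ioo (0 : ℝ) 1) := by simp
    _ ≤ volume ((⋂ n, F n) ∪ Set.Ioo (0 : ℝ) 1 \ ⋂ n, F n) :=
        measure_mono (by rw [Set.union_sdiff_self]; exact Set.subset_union_right)
    _ ≤ volume (⋂ n, F n) + volume (Set.Ioo (0 : ℝ) 1 \ ⋂ n, F n) := measure_union_le _ _
    _ = volume (⋂ n, F n) := by rw [hzero, add_zero]
end

section
/- Let (a_i)_{i≥1} be a nonincreasing sequence of positive real numbers and let M ≥ 2 be an integer. Then ∑_{i=1}^{∞} M^{2(i−1)}·a_{M^i} ≤ ∑_{i=1}^{∞} a_{⌊√i⌋} ≤ ∑_{i=0}^{∞} M^{2(i+1)}·a_{M^i}, as an inequality of sums in [0,∞] (each sum may be infinite). -/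
open Finset in
/-- Splitting a series indexed by the positive integers into the blocks `[N ^ k, N ^ (k + 1))`. -/
theorem ENNReal.tsum_sum_Ico_pow (g : ℕ → ENNReal) {N : ℕ} (hN : 2 ≤ N) :
    ∑' k : ℕ, ∑ j ∈ Ico (N ^ k) (N ^ (k + 1)), g j = ∑' i : ℕ, g (i + 1) := by
  have hblocks (n : ℕ) :
      ∑ k ∈ range n, ∑ j ∈ Ico (N ^ k) (N ^ (k + 1)), g j = ∑ j ∈ Ico 1 (N ^ n), g j := by
    induction n with
    | zero => simp
    | succ n ih =>
      rw [sum_range_succ, ih, sum_Ico_consecutive _ (Nat.one_le_pow _ _ (by omega))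
        (Nat.pow_le_pow_right (by omega) n.le_succ)]
  have hshift (n : ℕ) : ∑ i ∈ range n, g (i + 1) = ∑ j ∈ Ico 1 (n + 1), g j := by
    rw [range_eq_Ico, sum_Ico_add']
  apply le_antisymm
  · refine ENNReal.tsum_le_of_sum_range_le fun n => ?_
    have hn : N ^ n - 1 + 1 = N ^ n := Nat.sub_add_cancel (Nat.one_le_pow _ _ (by omega))
    rw [hblocks, ← hn, ← hshift]
    exact ENNReal.sum_le_tsum _
  · refine ENNReal.tsum_le_of_sum_range_le fun n => ?_
    calc ∑ i ∈ range n, g (i + 1) = ∑ j ∈ Ico 1 (n + 1), g j := hshift n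
      _ ≤ ∑ j ∈ Ico 1 (N ^ n), g j :=
        sum_le_sum_of_subset (Ico_subset_Ico_right (Nat.lt_pow_self (by omega)))
      _ = ∑ k ∈ range n, ∑ j ∈ Ico (N ^ k) (N ^ (k + 1)), g j := (hblocks n).symm
      _ ≤ _ := ENNReal.sum_le_tsum _

/-- Condensation-type comparison from Proposition 8 of the paper:
for a nonincreasing sequence `(a_i)_{i ≥ 1}` of positive reals and an integer `M ≥ 2`,
`∑_{i=1}^∞ M^{2(i-1)} a_{M^i} ≤ ∑_{i=1}^∞ a_{⌊√i⌋} ≤ ∑_{i=0}^∞ M^{2(i+1)} a_{M^i}`,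
as sums in `[0,∞]`. -/
theorem stmt_3
    (a : ℕ → ℝ) (hpos : ∀ i, 1 ≤ i → 0 < a i)
    (hmono : ∀ i j, 1 ≤ i → i ≤ j → a j ≤ a i)
    (M : ℕ) (hM : 2 ≤ M) :
    (∑' i : ℕ, ENNReal.ofReal ((M : ℝ) ^ (2 * i) * a (M ^ (i + 1)))) ≤
        (∑' i : ℕ, ENNReal.ofReal (a (Nat.sqrt (i + 1)))) ∧
      (∑' i : ℕ, ENNReal.ofReal (a (Nat.sqrt (i + 1)))) ≤
        (∑' i : ℕ, ENNReal.ofReal ((M : ℝ) ^ (2 * (i + 1)) * a (M ^ i))) := by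
  have hsq : 4 ≤ M ^ 2 := by nlinarith
  have hofReal (n k : ℕ) : ENNReal.ofReal ((M : ℝ) ^ (2 * n) * a k) =
      (((M ^ 2) ^ n : ℕ) : ENNReal) * ENNReal.ofReal (a k) := by
    rw [pow_mul, ENNReal.ofReal_mul (by positivity), ← ENNReal.ofReal_natCast]
    push_cast
    rfl
  rw [← ENNReal.tsum_sum_Ico_pow (fun i => ENNReal.ofReal (a (Nat.sqrt i)))
    (show 2 ≤ M ^ 2 by omega)]
  constructor <;> refine ENNReal.tsum_le_tsum fun k => ?_
  · have hcard : (M ^ 2) ^ k ≤ (Finset.Ico ((M ^ 2) ^ k) ((M ^ 2) ^ (k + 1))).card := by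
      rw [Nat.card_Ico, pow_succ (M ^ 2) k]
      have := Nat.mul_le_mul_left ((M ^ 2) ^ k) hsq
      omega
    rw [hofReal]
    refine le_trans (mul_le_mul_left (Nat.cast_le.2 hcard) _) ?_
    rw [← nsmul_eq_mul]
    refine Finset.card_nsmul_le_sum _ _ _ fun j hj => ENNReal.ofReal_le_ofReal ?_
    obtain ⟨hj₁, hj₂⟩ := Finset.mem_Ico.1 hj
    refine hmono _ _ (Nat.sqrt_pos.2 ((pow_pos (by omega) k).trans_le hj₁)) ?_
    refine (Nat.sqrt_lt'.2 ?_).le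
    rwa [← pow_mul, mul_comm, pow_mul]
  · have hcard : (Finset.Ico ((M ^ 2) ^ k) ((M ^ 2) ^ (k + 1))).card ≤ (M ^ 2) ^ (k + 1) := by
      rw [Nat.card_Ico]
      exact Nat.sub_le _ _
    rw [hofReal]
    refine le_trans ?_ (mul_le_mul_left (Nat.cast_le.2 hcard) _)
    rw [← nsmul_eq_mul]
    refine Finset.sum_le_card_nsmul _ _ _ fun j hj => ENNReal.ofReal_le_ofReal ?_
    obtain ⟨hj₁, -⟩ := Finset.mem_Ico.1 hj
    refine hmono _ _ (Nat.one_le_pow _ _ (by omega)) (Nat.le_sqrt'.2 ?_)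
    rwa [← pow_mul, mul_comm, pow_mul]
end
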